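/- Let γ satisfy the stated smoothness, monotonicity and curvature conditions, and let ω := limsup_{t→0⁺} ln|γ(t)|/ln t. If 1/q ≤ 1/p and 1 + (1 + ω)(1/q − 1/p) > 0, then the series Σ_{j ∈ ℤ, j ≤ 0} 2^j · |2^j γ(2^j)|^{1/q − 1/p} converges (is finite). -/

import Mathlib

open MeasureTheory Filter Topology Set ENNReal

/-- `ω := limsup_{t → 0⁺} ln |γ(t)| / ln t`. -/
noncomputable def curveExponent (γ : ℝ → ℝ) : ℝ :=
  Filter.limsup (fun t : ℝ => Real.log |γ t| / Real.log t) (𝓝[>] (0:ℝ))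

/-- A function on `(0, 1]` whose logarithmic derivative is at most `C / t` in absolute value
decays at most like `t ^ C` at the origin. -/
lemma log_one_add_mul_log_le_log {γ : ℝ → ℝ} {C : ℝ}
    (hd : DifferentiableOn ℝ γ (Ioc 0 1)) (h0 : ∀ t ∈ Ioc (0:ℝ) 1, γ t ≠ 0)
    (hC : ∀ t ∈ Ioc (0:ℝ) 1, |t * derivWithin γ (Ioc 0 1) t / γ t| ≤ C)
    {t : ℝ} (ht : t ∈ Ioc (0:ℝ) 1) :
    Real.log (γ 1) + C * Real.log t ≤ Real.log (γ t) := by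
  have hanti : AntitoneOn (fun x => Real.log (γ x) - C * Real.log x) (Ioc 0 1) := by
    have hderiv : ∀ x ∈ Ioo (0:ℝ) 1, HasDerivAt (fun x => Real.log (γ x) - C * Real.log x)
        (derivWithin γ (Ioc 0 1) x / γ x - C * x⁻¹) x := by
      intro x hx
      have hnhds : Ioc (0:ℝ) 1 ∈ 𝓝 x := Ioc_mem_nhds hx.1 hx.2
      have hx' : x ∈ Ioc (0:ℝ) 1 := ⟨hx.1, hx.2.le⟩
      have hγ := ((hd x hx').hasDerivWithinAt.hasDerivAt hnhds).log (h0 x hx')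
      exact hγ.sub ((Real.hasDerivAt_log hx.1.ne').const_mul C)
    refine antitoneOn_of_deriv_nonpos (convex_Ioc 0 1) ?_ ?_ ?_
    · exact (hd.continuousOn.log h0).sub
        (continuousOn_const.mul (continuousOn_id.log fun x hx => hx.1.ne'))
    · rw [interior_Ioc]
      exact fun x hx => (hderiv x hx).differentiableAt.differentiableWithinAt
    · rw [interior_Ioc]
      intro x hx
      rw [(hderiv x hx).deriv, sub_nonpos, ← div_eq_mul_inv, le_div_iff₀ hx.1]
      have h := (abs_le.1 (hC x ⟨hx.1, hx.2.le⟩)).2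
      rwa [mul_div_assoc, mul_comm] at h
  have h := hanti ht (right_mem_Ioc.2 one_pos) ht.2
  simp only [Real.log_one, mul_zero, sub_zero] at h
  linarith

/-- The quotient `log |γ t| / log t` is bounded above near the origin when `|γ|` decays at most
polynomially. -/
lemma isBoundedUnder_log_div_log {γ : ℝ → ℝ} {A C : ℝ}
    (h : ∀ t ∈ Ioc (0:ℝ) 1, A + C * Real.log t ≤ Real.log (γ t)) :
    IsBoundedUnder (· ≤ ·) (𝓝[>] (0:ℝ)) fun t => Real.log |γ t| / Real.log t := by
  refine ⟨C + |A|, eventually_map.2 ?_⟩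
  filter_upwards [Ioo_mem_nhdsGT (Real.exp_pos (-1))] with t ht
  have hlog : Real.log t < -1 := (Real.log_lt_iff_lt_exp ht.1).2 ht.2
  have ht1 : t ≤ 1 := ht.2.le.trans (Real.exp_le_one_iff.2 (by norm_num))
  rw [Real.log_abs, div_le_iff_of_neg (by linarith)]
  nlinarith [h t ⟨ht.1, ht1⟩, neg_abs_le A, abs_nonneg A]

/-- If `t ^ w ≤ |γ t|` then `t |t γ(t)| ^ s` is at most `t ^ (1 + (1 + w) s)` for `s ≤ 0`. -/
lemma mul_abs_mul_rpow_le {t y w s : ℝ} (ht : 0 < t) (hs : s ≤ 0) (h : t ^ w ≤ |y|) :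
    t * |t * y| ^ s ≤ t ^ (1 + (1 + w) * s) := by
  have hle : t ^ (1 + w) ≤ |t * y| := by
    rw [Real.rpow_add ht, Real.rpow_one, abs_mul, abs_of_pos ht]
    gcongr
  rw [Real.rpow_add ht, Real.rpow_one, Real.rpow_mul ht.le]
  exact mul_le_mul_of_nonneg_left
    (Real.rpow_le_rpow_of_nonpos (Real.rpow_pos_of_pos ht _) hle hs) ht.le

/-- Convergence of the dyadic series, given boundedness of `log |γ t| / log t`. -/
lemma summable_dyadic_of_curveExponent {γ : ℝ → ℝ} {s : ℝ}
    (h0 : ∀ t ∈ Ioc (0:ℝ) 1, γ t ≠ 0)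
    (hb : IsBoundedUnder (· ≤ ·) (𝓝[>] (0:ℝ)) fun t => Real.log |γ t| / Real.log t)
    (hs : s ≤ 0) (hω : 0 < 1 + (1 + curveExponent γ) * s) :
    Summable fun n : ℕ =>
      (2:ℝ) ^ (-(n:ℤ)) * |(2:ℝ) ^ (-(n:ℤ)) * γ ((2:ℝ) ^ (-(n:ℤ)))| ^ s := by
  obtain ⟨w, hw, hpos⟩ : ∃ w, curveExponent γ < w ∧ 0 < 1 + (1 + w) * s := by
    have hcont : Continuous fun w : ℝ => 1 + (1 + w) * s := by fun_prop
    have hev : ∀ᶠ w in 𝓝[>] (curveExponent γ), 0 < 1 + (1 + w) * s :=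
      (hcont.continuousAt.eventually (lt_mem_nhds hω)).filter_mono nhdsWithin_le_nhds
    obtain ⟨w, h₁, h₂⟩ := (hev.and self_mem_nhdsWithin).exists
    exact ⟨w, h₂, h₁⟩
  have hev : ∀ᶠ t in 𝓝[>] (0:ℝ), t * |t * γ t| ^ s ≤ t ^ (1 + (1 + w) * s) := by
    filter_upwards [eventually_lt_of_limsup_lt hw hb, Ioo_mem_nhdsGT one_pos] with t hlt ht
    refine mul_abs_mul_rpow_le ht.1 hs ?_
    rw [div_lt_iff_of_neg (Real.log_neg ht.1 ht.2)] at hlt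
    rw [← Real.log_le_log_iff (Real.rpow_pos_of_pos ht.1 _)
      (abs_pos.2 (h0 t ⟨ht.1, ht.2.le⟩)), Real.log_rpow ht.1]
    exact hlt.le
  have hdyadic : Tendsto (fun n : ℕ => (2:ℝ) ^ (-(n:ℤ))) atTop (𝓝[>] 0) := by
    refine tendsto_nhdsWithin_iff.2 ⟨?_, Eventually.of_forall fun n => by simp⟩
    have := tendsto_pow_atTop_nhds_zero_of_lt_one (r := (2⁻¹ : ℝ)) (by norm_num) (by norm_num)
    simpa [zpow_neg] using this
  have hgeom : Summable fun n : ℕ => ((2:ℝ) ^ (-(n:ℤ))) ^ (1 + (1 + w) * s) := by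
    have hr := summable_geometric_of_lt_one (r := (2⁻¹ : ℝ) ^ (1 + (1 + w) * s))
      (by positivity) (Real.rpow_lt_one (by norm_num) (by norm_num) hpos)
    refine hr.congr fun n => ?_
    rw [zpow_neg, zpow_natCast, ← inv_pow, ← Real.rpow_natCast, ← Real.rpow_natCast,
      ← Real.rpow_mul (by norm_num), ← Real.rpow_mul (by norm_num), mul_comm]
  refine hgeom.of_norm_bounded_eventually_nat ?_
  filter_upwards [hdyadic.eventually hev] with n hn
  rwa [Real.norm_of_nonneg (by positivity)]

theorem stmt7 :
    ∃ N₀ : ℕ, ∀ N : ℕ, N₀ ≤ N →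
    ∀ (γ : ℝ → ℝ) (C₁ C₂ : ℕ → ℝ) (p q : ℝ≥0∞),
      ContDiffOn ℝ (N : ℕ∞) γ (Set.Ioc 0 1) →
      Tendsto γ (𝓝[>] (0:ℝ)) (𝓝 0) →
      (MonotoneOn γ (Set.Ioc 0 1) ∨ AntitoneOn γ (Set.Ioc 0 1)) →
      (∀ j : ℕ, 1 ≤ j → j ≤ 2 → 0 < C₁ j ∧ ∀ t ∈ Set.Ioc (0:ℝ) 1,
        C₁ j ≤ |t ^ j * iteratedDerivWithin j γ (Set.Ioc 0 1) t / γ t|) →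
      (∀ j : ℕ, 1 ≤ j → j ≤ N → 0 < C₂ j ∧ ∀ t ∈ Set.Ioc (0:ℝ) 1,
        |t ^ j * iteratedDerivWithin j γ (Set.Ioc 0 1) t / γ t| ≤ C₂ j) →
      1 ≤ p → 1 ≤ q →
      (1/q).toReal ≤ (1/p).toReal →
      1 + (1 + curveExponent γ) * ((1/q).toReal - (1/p).toReal) > 0 →
      Summable (fun n : ℕ =>
        (2:ℝ) ^ (-(n:ℤ)) *
          |(2:ℝ) ^ (-(n:ℤ)) * γ ((2:ℝ) ^ (-(n:ℤ)))| ^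
            ((1/q).toReal - (1/p).toReal)) := by
  refine ⟨1, fun N hN γ C₁ C₂ p q hγ _ _ hlow hup _ _ hpq hω => ?_⟩
  obtain ⟨hC₁, hlow⟩ := hlow 1 le_rfl one_le_two
  obtain ⟨-, hup⟩ := hup 1 le_rfl hN
  have h0 : ∀ t ∈ Ioc (0:ℝ) 1, γ t ≠ 0 := by
    intro t ht h
    have := hlow t ht
    rw [h, _root_.div_zero, abs_zero] at this
    linarith
  simp only [pow_one, iteratedDerivWithin_one] at hup
  have hd : DifferentiableOn ℝ γ (Ioc 0 1) :=
    hγ.differentiableOn (by exact_mod_cast (Nat.one_le_iff_ne_zero.1 hN))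
  exact summable_dyadic_of_curveExponent h0
    (isBoundedUnder_log_div_log fun t ht => log_one_add_mul_log_le_log hd h0 hup ht)
    (sub_nonpos.2 hpq) hω
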